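/- Let n ≥ 3 be an odd integer, let B ≥ 1 be a squarefree integer with B ≡ 1 or 2 (mod 4), and let K = ℚ(√(−B)) with ring of integers O_K. Let C be an odd positive squarefree integer coprime to B such that every prime divisor of C splits in K, and suppose that n is coprime to the class number of K. Then there exist integers x, y, z with gcd(x, y, z) = 1, z ≠ 0, and x² + B·y² = C·z^n. -/

import Mathlib

/-- If `a, b : ℚ` are such that `2 a` (the trace of `a + b √-B`) and `a² + B b²` (its norm) are
integers, then `a` and `b` are integers. -/
theorem exists_int_of_two_mul_of_norm {B : ℤ} (hBsf : Squarefree B)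
    (hBmod : B ≡ 1 [ZMOD 4] ∨ B ≡ 2 [ZMOD 4]) {a b : ℚ} {t N : ℤ}
    (ht : (t : ℚ) = 2 * a) (hN : (N : ℚ) = a ^ 2 + B * b ^ 2) :
    ∃ x y : ℤ, a = x ∧ b = y := by
  have h1 : (B : ℚ) * (2 * b) ^ 2 = ((4 * N - t ^ 2 : ℤ) : ℚ) := by
    push_cast; rw [hN, ht]; ring
  have hden : ((2 * b).den : ℤ) * (2 * b).den ∣ B := by
    have h2 : B * (2 * b).num ^ 2 = (4 * N - t ^ 2) * (2 * b).den ^ 2 := by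
      have h4 := Rat.num_div_den (2 * b)
      rw [← h4] at h1
      have h5 : ((2 * b).den : ℚ) ≠ 0 := by exact_mod_cast (2 * b).den_nz
      field_simp at h1
      rw [mul_comm (4 * N - t ^ 2)]
      exact_mod_cast h1
    have hcop : IsCoprime (((2 * b).den : ℤ) ^ 2) ((2 * b).num ^ 2) := by
      apply IsCoprime.pow
      rw [Int.isCoprime_iff_gcd_eq_one, Int.gcd_comm]
      simpa [Int.gcd] using (2 * b).reduced
    rw [← pow_two]
    exact hcop.dvd_of_dvd_mul_right (Dvd.intro_left _ h2.symm)
  have hone : (2 * b).den = 1 := by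
    simpa [Int.isUnit_iff_natAbs_eq] using hBsf _ hden
  obtain ⟨s, hs⟩ : ∃ s : ℤ, (s : ℚ) = 2 * b := ⟨_, Rat.coe_int_num_of_den_eq_one hone⟩
  have h6 : B * s ^ 2 = 4 * N - t ^ 2 := by
    rw [← hs] at h1; exact_mod_cast h1
  have h7 : (2 : ℤ) ∣ t ∧ (2 : ℤ) ∣ s := by
    have h8 : ∀ B s t : ZMod 4, (B = 1 ∨ B = 2) → B * s ^ 2 + t ^ 2 = 0 →
        2 * t = 0 ∧ 2 * s = 0 := by decide
    have h9 := h8 B s t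
      (by
        rcases hBmod with h | h
        · left; exact_mod_cast (ZMod.intCast_eq_intCast_iff _ _ 4).2 h
        · right; exact_mod_cast (ZMod.intCast_eq_intCast_iff _ _ 4).2 h)
      (by
        have h10 : ((B * s ^ 2 + t ^ 2 : ℤ) : ZMod 4) = 0 := by
          rw [ZMod.intCast_zmod_eq_zero_iff_dvd]
          exact ⟨N, by push_cast; linarith⟩
        exact_mod_cast h10)
    have h11 : ∀ u : ℤ, 2 * (u : ZMod 4) = 0 → (2 : ℤ) ∣ u := by
      intro u hu
      have h12 : ((2 * u : ℤ) : ZMod 4) = 0 := by exact_mod_cast hu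
      rw [ZMod.intCast_zmod_eq_zero_iff_dvd] at h12
      push_cast at h12
      omega
    exact ⟨h11 _ h9.1, h11 _ h9.2⟩
  obtain ⟨⟨x, rfl⟩, ⟨y, rfl⟩⟩ := h7
  refine ⟨x, y, ?_, ?_⟩
  · push_cast at ht; linarith
  · push_cast at hs; linarith

/-- Coordinates, trace and norm in an imaginary quadratic field. -/
theorem exists_coords_trace_norm {K : Type*} [Field K] [NumberField K]
    (hK2 : Module.finrank ℚ K = 2) {B : ℤ} (hB1 : 1 ≤ B) {α : K} (hα : α ^ 2 = -(B : K)) (w : K) :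
    ∃ a b : ℚ, w = a + b * α ∧ Algebra.trace ℚ K w = 2 * a ∧
      Algebra.norm ℚ w = a ^ 2 + B * b ^ 2 := by
  have hli : LinearIndependent ℚ ![(1 : K), α] := by
    rw [LinearIndependent.pair_iff]
    intro s t hst
    have h1 : (s : K) = -(t * α) := by
      simp only [Algebra.smul_def, eq_ratCast, mul_one] at hst
      linear_combination hst
    have h2 : (s : K) ^ 2 = -(B * t ^ 2) := by
      rw [h1]; linear_combination (t : K) ^ 2 * hα
    have h3 : s ^ 2 = -((B : ℚ) * t ^ 2) := by exact_mod_cast h2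
    have hB : (1 : ℚ) ≤ B := by exact_mod_cast hB1
    have ht : t ^ 2 = 0 := by nlinarith [sq_nonneg s, sq_nonneg t]
    have hs : s ^ 2 = 0 := by rw [h3, ht]; simp
    exact ⟨by simpa using hs, by simpa using ht⟩
  let v := basisOfLinearIndependentOfCardEqFinrank hli (by simp [hK2])
  have hv0 : v 0 = 1 := by simp [v]
  have hv1 : v 1 = α := by simp [v]
  have hw : w = (v.repr w 0 : K) + v.repr w 1 * α := by
    conv_lhs => rw [← v.sum_repr w]
    simp [Fin.sum_univ_two, hv0, hv1, Algebra.smul_def]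
  have hrepr : ∀ c d : ℚ, v.repr ((c : K) + d * α) = Finsupp.single 0 c + Finsupp.single 1 d := by
    intro c d
    have : (c : K) + d * α = c • v 0 + d • v 1 := by
      simp [hv0, hv1, Algebra.smul_def]
    rw [this, map_add, map_smul, map_smul, v.repr_self, v.repr_self]
    simp
  set a := v.repr w 0 with ha
  set b := v.repr w 1 with hb
  have hM : Algebra.leftMulMatrix v w = !![a, -(B * b); b, a] := by
    have e0 : w * v 0 = (a : K) + b * α := by rw [hv0, mul_one]; exact hw
    have e1 : w * v 1 = ((-(B * b) : ℚ) : K) + a * α := by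
      rw [hv1, hw]; push_cast; linear_combination (b : K) * hα
    ext i j
    rw [Algebra.leftMulMatrix_eq_repr_mul]
    fin_cases j
    · simp only [Fin.zero_eta]
      rw [e0, hrepr]
      fin_cases i <;> simp
    · simp only [Fin.mk_one]
      rw [e1, hrepr]
      fin_cases i <;> simp
  refine ⟨a, b, hw, ?_, ?_⟩
  · rw [Algebra.trace_eq_matrix_trace v, hM, Matrix.trace_fin_two_of]; ring
  · rw [Algebra.norm_eq_matrix_det v, hM, Matrix.det_fin_two_of]; ring

open NumberField in
/-- In the case `B ≡ 1, 2 (mod 4)` the ring of integers is `ℤ[√-B]`. -/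
theorem exists_int_coords_norm {K : Type*} [Field K] [NumberField K]
    (hK2 : Module.finrank ℚ K = 2) {B : ℤ} (hB1 : 1 ≤ B) (hBsf : Squarefree B)
    (hBmod : B ≡ 1 [ZMOD 4] ∨ B ≡ 2 [ZMOD 4]) {α : 𝓞 K} (hα : α ^ 2 = -(B : 𝓞 K)) (w : 𝓞 K) :
    ∃ x y : ℤ, w = x + y * α ∧ Algebra.norm ℤ w = x ^ 2 + B * y ^ 2 := by
  have hα' : (α : K) ^ 2 = -(B : K) := by
    simpa using congrArg (algebraMap (𝓞 K) K) hα
  obtain ⟨a, b, hw, htr, hnorm⟩ := exists_coords_trace_norm hK2 hB1 hα' (w : K)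
  rw [← Algebra.coe_trace_int] at htr
  rw [← Algebra.coe_norm_int] at hnorm
  obtain ⟨x, y, rfl, rfl⟩ := exists_int_of_two_mul_of_norm hBsf hBmod htr hnorm
  refine ⟨x, y, ?_, by exact_mod_cast hnorm⟩
  apply RingOfIntegers.coe_injective
  simpa using hw

open scoped nonZeroDivisors in
/-- Every ideal class contains an integral ideal coprime to a given nonzero ideal. -/
theorem ClassGroup.exists_mk0_eq_isCoprime {R : Type*} [CommRing R] [IsDedekindDomain R]
    (g : ClassGroup R) {J : Ideal R} (hJ : J ≠ 0) :
    ∃ Z : (Ideal R)⁰, ClassGroup.mk0 Z = g ∧ IsCoprime (Z : Ideal R) J := by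
  by_cases hJtop : J = ⊤
  · obtain ⟨Z, hZ⟩ := ClassGroup.mk0_surjective g
    exact ⟨Z, hZ, Ideal.isCoprime_iff_sup_eq.2 (by simp [hJtop])⟩
  obtain ⟨I, hI⟩ := ClassGroup.mk0_surjective g⁻¹
  have hI0 : (I : Ideal R) ≠ 0 := nonZeroDivisors.coe_ne_zero I
  obtain ⟨a, ha⟩ := IsDedekindDomain.exists_sup_span_eq
    (I := (I : Ideal R) * J) (J := I) Ideal.mul_le_left (mul_ne_zero hI0 hJ)
  obtain ⟨Z, hZ⟩ : (I : Ideal R) ∣ Ideal.span {a} :=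
    Ideal.dvd_iff_le.2 (ha ▸ le_sup_right)
  rw [hZ, ← Ideal.mul_sup] at ha
  have hsup : J ⊔ Z = ⊤ := mul_left_cancel₀ hI0 (by rw [ha, Ideal.mul_top])
  have hcop : IsCoprime Z J := by
    rw [Ideal.isCoprime_iff_sup_eq, sup_comm, hsup]
  have hZ0 : Z ≠ 0 := by
    rintro rfl
    exact hJtop (by simpa using hsup)
  refine ⟨⟨Z, mem_nonZeroDivisors_of_ne_zero hZ0⟩, ?_, hcop⟩
  rw [← inv_inv g, ← hI, ClassGroup.mk0_eq_mk0_inv_iff]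
  refine ⟨a, ?_, by rw [mul_comm]; exact hZ.symm⟩
  rintro rfl
  have : (I : Ideal R) * Z = 0 := by rw [← hZ]; simp
  exact mul_ne_zero hI0 hZ0 this

open NumberField in
/-- The ideal generated by a natural number `p` has norm `p ^ [K : ℚ]`. -/
theorem NumberField.absNorm_span_natCast (K : Type*) [Field K] [NumberField K] (p : ℕ) :
    Ideal.absNorm (Ideal.span {(p : 𝓞 K)}) = p ^ Module.finrank ℚ K := by
  have h := Algebra.norm_algebraMap (S := 𝓞 K) (p : ℤ)
  rw [RingOfIntegers.rank, map_natCast] at h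
  rw [Ideal.absNorm_span_singleton, h]
  simp [Int.natAbs_pow]

open NumberField nonZeroDivisors in
/-- Every ideal class contains an integral ideal coprime to a given nonzero ideal and not
divisible by any rational prime. -/
theorem NumberField.exists_mk0_eq_isCoprime_primitive {K : Type*} [Field K] [NumberField K]
    (g : ClassGroup (𝓞 K)) {J : Ideal (𝓞 K)} (hJ : J ≠ 0) :
    ∃ Z : (Ideal (𝓞 K))⁰, ClassGroup.mk0 Z = g ∧ IsCoprime (Z : Ideal (𝓞 K)) J ∧
      ∀ q : ℕ, q.Prime → ¬ (Z : Ideal (𝓞 K)) ≤ Ideal.span {(q : 𝓞 K)} := by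
  obtain ⟨Z, ⟨hZg, hZJ⟩, hmin⟩ := WellFounded.has_min
    (InvImage.wf (fun Z : (Ideal (𝓞 K))⁰ => Ideal.absNorm (Z : Ideal (𝓞 K))) wellFounded_lt)
    {Z | ClassGroup.mk0 Z = g ∧ IsCoprime (Z : Ideal (𝓞 K)) J}
    (ClassGroup.exists_mk0_eq_isCoprime g hJ)
  refine ⟨Z, hZg, hZJ, fun q hq hle => ?_⟩
  obtain ⟨W, hW⟩ := Ideal.dvd_iff_le.2 hle
  have hZ0 : (Z : Ideal (𝓞 K)) ≠ 0 := nonZeroDivisors.coe_ne_zero Z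
  have hW0 : W ≠ 0 := by
    rintro rfl
    exact hZ0 (by rw [hW, mul_zero])
  have hq0 : (q : 𝓞 K) ≠ 0 := by exact_mod_cast hq.ne_zero
  refine hmin ⟨W, mem_nonZeroDivisors_of_ne_zero hW0⟩ ⟨?_, ?_⟩ ?_
  · rw [← hZg, ClassGroup.mk0_eq_mk0_iff]
    exact ⟨q, 1, hq0, one_ne_zero, by simp [hW]⟩
  · rw [Ideal.isCoprime_iff_sup_eq] at hZJ ⊢
    refine top_le_iff.1 (hZJ ▸ sup_le_sup_right ?_ J)
    exact hW.le.trans Ideal.mul_le_right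
  · change Ideal.absNorm W < Ideal.absNorm (Z : Ideal (𝓞 K))
    rw [hW, map_mul, absNorm_span_natCast]
    have hWpos : 0 < Ideal.absNorm W :=
      Nat.pos_of_ne_zero (by rwa [Ne, Ideal.absNorm_eq_zero_iff])
    exact lt_mul_of_one_lt_left hWpos (Nat.one_lt_pow Module.finrank_pos.ne' hq.one_lt)

open NumberField in
/-- If every prime factor of `c` splits in the quadratic field `K`, then `c` is the norm of an
ideal. -/
theorem NumberField.exists_absNorm_eq_of_split {K : Type*} [Field K] [NumberField K]
    (hK2 : Module.finrank ℚ K = 2) (c : ℕ) (hc : c ≠ 0)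
    (hsplit : ∀ p : ℕ, p.Prime → p ∣ c → ∃ P Q : Ideal (𝓞 K),
      P.IsPrime ∧ Q.IsPrime ∧ P * Q = Ideal.span {(p : 𝓞 K)}) :
    ∃ J : Ideal (𝓞 K), Ideal.absNorm J = c := by
  induction c using induction_on_primes with
  | zero => exact absurd rfl hc
  | one => exact ⟨⊤, Ideal.absNorm_top⟩
  | prime_mul p a hp ih =>
    obtain ⟨J, hJ⟩ := ih (right_ne_zero_of_mul hc)
      fun q hq hqa => hsplit q hq (hqa.mul_left p)
    obtain ⟨P, Q, hP, hQ, hPQ⟩ := hsplit p hp (dvd_mul_right p a)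
    have hnorm : Ideal.absNorm P * Ideal.absNorm Q = p ^ 2 := by
      rw [← map_mul, hPQ, absNorm_span_natCast, hK2]
    have hPp : Ideal.absNorm P = p :=
      ((Nat.Prime.mul_eq_prime_sq_iff hp
        (mt Ideal.absNorm_eq_one_iff.1 hP.ne_top)
        (mt Ideal.absNorm_eq_one_iff.1 hQ.ne_top)).1 hnorm).1
    exact ⟨P * J, by rw [map_mul, hPp, hJ]⟩

open NumberField in
/-- A rational prime not dividing `2 B` is unramified in `ℚ(√-B)`. -/
theorem NumberField.isRadical_natCast_of_prime {K : Type*} [Field K] [NumberField K]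
    (hK2 : Module.finrank ℚ K = 2) {B : ℤ} (hB1 : 1 ≤ B) (hBsf : Squarefree B)
    (hBmod : B ≡ 1 [ZMOD 4] ∨ B ≡ 2 [ZMOD 4]) {α : 𝓞 K} (hα : α ^ 2 = -(B : 𝓞 K))
    {q : ℕ} (hq : q.Prime) (hqB : ¬ (q : ℤ) ∣ 2 * B) : IsRadical (q : 𝓞 K) := by
  rw [isRadical_iff_pow_one_lt 2 one_lt_two]
  intro w hw
  obtain ⟨x, y, rfl, hn⟩ := exists_int_coords_norm hK2 hB1 hBsf hBmod hα w
  have hqp : Prime (q : ℤ) := Nat.prime_iff_prime_int.1 hq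
  have hcast : ∀ {k : ℤ}, (q : ℤ) ∣ k → (q : 𝓞 K) ∣ k := fun h => by
    exact_mod_cast Int.cast_dvd_cast (α := 𝓞 K) _ _ h
  have hqN : (q : ℤ) ∣ x ^ 2 + B * y ^ 2 := by
    have h := map_dvd (Algebra.norm ℤ) hw
    have hqn := Algebra.norm_algebraMap (S := 𝓞 K) (q : ℤ)
    rw [RingOfIntegers.rank, hK2, map_natCast] at hqn
    rw [hqn, map_pow, hn] at h
    exact hqp.dvd_of_dvd_pow ((dvd_pow_self _ two_ne_zero).trans h)
  by_cases hqx : (q : ℤ) ∣ x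
  · have hqy : (q : ℤ) ∣ y := by
      have h := (Int.dvd_add_right (hqx.trans (dvd_pow_self x two_ne_zero))).1 hqN
      exact hqp.dvd_of_dvd_pow
        ((hqp.dvd_or_dvd h).resolve_left fun h' => hqB (h'.mul_left 2))
    exact dvd_add (hcast hqx) ((hcast hqy).mul_right _)
  · have hcop : IsCoprime (q : ℤ) (2 * x) := by
      refine (hqp.coprime_iff_not_dvd).2 fun h => ?_
      exact (hqp.dvd_or_dvd h).elim (fun h' => hqB (h'.mul_right B)) hqx
    have hcop' : IsCoprime (q : 𝓞 K) ((2 * x : ℤ) : 𝓞 K) := by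
      simpa using hcop.map (Int.castRingHom (𝓞 K))
    refine hcop'.dvd_of_dvd_mul_left ?_
    convert dvd_add hw (hcast hqN) using 1
    push_cast
    linear_combination -(y : 𝓞 K) ^ 2 * hα

open NumberField in
/-- Let `K = ℚ(√-B)` with `B ≥ 1` squarefree and `B ≡ 1, 2 (mod 4)` (so that
`𝓞 K = ℤ[√-B]`, witnessed by `α ∈ 𝓞 K` with `α² = -B`). If `C` is an odd positive
squarefree integer coprime to `B`, all of whose prime divisors split in `K`, and `n`
is coprime to the class number of `K`, then `x² + B y² = C zⁿ` has a primitive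
integer solution with `z ≠ 0`. -/
theorem stmt_19 (n : ℕ) (hn3 : 3 ≤ n) (hnodd : Odd n)
    (B : ℤ) (hB1 : 1 ≤ B) (hBsf : Squarefree B)
    (hBmod : B ≡ 1 [ZMOD 4] ∨ B ≡ 2 [ZMOD 4])
    (K : Type*) [Field K] [NumberField K] (hK2 : Module.finrank ℚ K = 2)
    (α : 𝓞 K) (hα : α ^ 2 = -(B : 𝓞 K))
    (C : ℤ) (hC0 : 0 < C) (hCodd : Odd C) (hCsf : Squarefree C)
    (hBC : Int.gcd B C = 1)
    (hsplit : ∀ p : ℕ, p.Prime → (p : ℤ) ∣ C →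
      ∃ P Q : Ideal (𝓞 K), P ≠ Q ∧ P.IsPrime ∧ Q.IsPrime ∧
        P * Q = Ideal.span {(p : 𝓞 K)})
    (hclass : Nat.Coprime n (classNumber K)) :
    ∃ x y z : ℤ, Int.gcd (Int.gcd x y) z = 1 ∧ z ≠ 0 ∧
      x ^ 2 + B * y ^ 2 = C * z ^ n := by
  obtain ⟨c, rfl⟩ := Int.eq_ofNat_of_zero_le hC0.le
  have hc0 : c ≠ 0 := by rintro rfl; simp at hC0
  obtain ⟨J, hJ⟩ := NumberField.exists_absNorm_eq_of_split hK2 c hc0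
    fun p hp hpc => by
      obtain ⟨P, Q, -, h⟩ := hsplit p hp (by exact_mod_cast hpc)
      exact ⟨P, Q, h⟩
  have hJ0 : J ≠ 0 := by
    rintro rfl
    exact hc0 (by simpa using hJ.symm)
  have hbij : Function.Bijective fun g : ClassGroup (𝓞 K) => g ^ n :=
    Nat.Coprime.pow_left_bijective (by
      rw [Nat.card_eq_fintype_card]; exact hclass.symm)
  obtain ⟨g, hg⟩ := hbij.surjective (ClassGroup.mk0 ⟨J, mem_nonZeroDivisors_of_ne_zero hJ0⟩)⁻¹
  have hM : Ideal.span {((2 * B * c : ℤ) : 𝓞 K)} ≠ 0 := by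
    have h : (2 * B * c : ℤ) ≠ 0 := by positivity
    simpa using h
  obtain ⟨Z, hZg, hZM, hZprim⟩ := NumberField.exists_mk0_eq_isCoprime_primitive g hM
  simp only [← hZg, ← map_pow] at hg
  obtain ⟨w, hw0, hw⟩ := ClassGroup.mk0_eq_mk0_inv_iff.1 hg
  rw [SubmonoidClass.coe_pow] at hw
  obtain ⟨x, y, rfl, hxy⟩ := exists_int_coords_norm hK2 hB1 hBsf hBmod hα w
  have hZ0 : Ideal.absNorm (Z : Ideal (𝓞 K)) ≠ 0 := by
    rw [Ne, Ideal.absNorm_eq_zero_iff]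
    exact nonZeroDivisors.coe_ne_zero Z
  refine ⟨x, y, Ideal.absNorm (Z : Ideal (𝓞 K)), ?_, by exact_mod_cast hZ0, ?_⟩
  swap
  · have h := congrArg Ideal.absNorm hw
    rw [map_mul, map_pow, hJ, Ideal.absNorm_span_singleton, hxy] at h
    have hpos : 0 ≤ x ^ 2 + B * y ^ 2 := by positivity
    rw [← Int.natAbs_of_nonneg hpos, ← h]
    push_cast; ring
  suffices hcop : Int.gcd x y = 1 by simp [hcop]
  by_contra hne
  obtain ⟨q, hq, hqd⟩ := Nat.exists_prime_and_dvd hne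
  have hqxy : (q : 𝓞 K) ∣ x + y * α := by
    have h1 : (q : ℤ) ∣ x := (Int.natCast_dvd_natCast.2 hqd).trans (Int.gcd_dvd_left ..)
    have h2 : (q : ℤ) ∣ y := (Int.natCast_dvd_natCast.2 hqd).trans (Int.gcd_dvd_right ..)
    refine dvd_add ?_ (Dvd.dvd.mul_right ?_ _)
    · exact_mod_cast Int.cast_dvd_cast (α := 𝓞 K) _ _ h1
    · exact_mod_cast Int.cast_dvd_cast (α := 𝓞 K) _ _ h2
  have hdvd : Ideal.span {(q : 𝓞 K)} ∣ (Z : Ideal (𝓞 K)) ^ n * J := by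
    rw [hw]
    exact Ideal.dvd_iff_le.2 (Ideal.span_singleton_le_span_singleton.2 hqxy)
  by_cases hqM : (q : ℤ) ∣ 2 * B * c
  · have hcopZ : IsCoprime (Ideal.span {(q : 𝓞 K)}) ((Z : Ideal (𝓞 K)) ^ n) := by
      refine (IsCoprime.pow_left ?_).symm
      refine hZM.of_isCoprime_of_dvd_right ?_
      rw [Ideal.dvd_iff_le, Ideal.span_singleton_le_span_singleton]
      exact_mod_cast Int.cast_dvd_cast (α := 𝓞 K) _ _ hqM
    have hqJ := map_dvd Ideal.absNorm (hcopZ.dvd_of_dvd_mul_left hdvd)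
    rw [NumberField.absNorm_span_natCast, hK2, hJ, pow_two] at hqJ
    have := hCsf q (by exact_mod_cast hqJ)
    exact hq.one_lt.ne' (by simpa [Int.isUnit_iff_natAbs_eq] using this)
  · have hrad := NumberField.isRadical_natCast_of_prime hK2 hB1 hBsf hBmod hα hq
      fun h => hqM (h.mul_right _)
    have hqc : IsCoprime (q : 𝓞 K) c := by
      have : Nat.Coprime q c := (Nat.Prime.coprime_iff_not_dvd hq).2 fun h =>
        hqM (Dvd.dvd.mul_left (by exact_mod_cast h) _)
      exact this.cast
    refine hZprim q hq fun b hb => Ideal.mem_span_singleton.2 (hrad n b ?_)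
    refine hqc.dvd_of_dvd_mul_right ?_
    rw [← Ideal.mem_span_singleton]
    refine Ideal.dvd_iff_le.1 hdvd (Ideal.mul_mem_mul (Ideal.pow_mem_pow hb n) ?_)
    exact hJ ▸ Ideal.absNorm_mem J
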